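/- Let f(s,z) = e^{z²μ(s)} ((s/2)/sinh(s/2))^b with μ(s) = 1/s − 1/(e^s−1) − 1/2, and Maclaurin expansion f(s,z) = Σ_{k≥0} c_k(z) s^k. Then for each k ≥ 0: 4(k+1) c_{k+1}(z) + 4z c_{k+1}'(z) = c_k''(z) + ((2b−1)/z) c_k'(z) − z² c_k(z). -/

import Mathlib

/-- `μ(s) = 1/s - 1/(e^s-1) - 1/2`, extended analytically to `s = 0` by `μ(0) = 0`. -/
noncomputable def temmeMu (s : ℂ) : ℂ :=
  if s = 0 then 0 else 1 / s - 1 / (Complex.exp s - 1) - 1 / 2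

/-- `((s/2)/sinh(s/2))^b`, extended analytically to `s = 0` by the value `1`. -/
noncomputable def temmeBase (b s : ℂ) : ℂ :=
  if s = 0 then 1 else ((s / 2) / Complex.sinh (s / 2)) ^ b

/-- Temme's function `f(s,z) = e^{z²μ(s)} ((s/2)/sinh(s/2))^b`. -/
noncomputable def temmeF (b s z : ℂ) : ℂ :=
  Complex.exp (z ^ 2 * temmeMu s) * temmeBase b s

/-- The Maclaurin coefficients `c_k(z)` of `s ↦ f(s,z)` at `s = 0`. -/
noncomputable def temmeC (b : ℂ) (k : ℕ) (z : ℂ) : ℂ :=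
  iteratedDeriv k (fun s => temmeF b s z) 0 / (k.factorial : ℂ)

open Filter Topology

/-- Auxiliary functional: `k`-th derivative at `0` of `e^{z² m(s)} h(s)`. -/
noncomputable def auxT (m : ℂ → ℂ) (k : ℕ) (h : ℂ → ℂ) (z : ℂ) : ℂ :=
  iteratedDeriv k (fun s => Complex.exp (z ^ 2 * m s) * h s) 0

lemma auxT_congr (m : ℂ → ℂ) (k : ℕ) {h g : ℂ → ℂ} (z : ℂ) (hg : h =ᶠ[𝓝 0] g) :
    auxT m k h z = auxT m k g z := by
  apply Filter.EventuallyEq.iteratedDeriv_eq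
  filter_upwards [hg] with s hs
  rw [hs]

lemma auxT_analytic {m h : ℂ → ℂ} (hm : AnalyticAt ℂ m 0) (hh : AnalyticAt ℂ h 0) (z : ℂ) :
    AnalyticAt ℂ (fun s => Complex.exp (z ^ 2 * m s) * h s) 0 := by
  fun_prop

lemma auxT_add {m h g : ℂ → ℂ} (hm : AnalyticAt ℂ m 0) (hh : AnalyticAt ℂ h 0)
    (hg : AnalyticAt ℂ g 0) (k : ℕ) (z : ℂ) :
    auxT m k (fun s => h s + g s) z = auxT m k h z + auxT m k g z := by
  unfold auxT
  rw [← iteratedDeriv_fun_add (auxT_analytic hm hh z).contDiffAt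
    (auxT_analytic hm hg z).contDiffAt]
  congr 1
  funext s
  ring

lemma auxT_const_mul (m h : ℂ → ℂ) (c : ℂ) (k : ℕ) (z : ℂ) :
    auxT m k (fun s => c * h s) z = c * auxT m k h z := by
  unfold auxT
  rw [← iteratedDeriv_const_mul_field]
  congr 1
  funext s
  ring

lemma auxT_succ {m h : ℂ → ℂ} (hm : AnalyticAt ℂ m 0) (hh : AnalyticAt ℂ h 0) (k : ℕ) (z : ℂ) :
    auxT m (k + 1) h z = z ^ 2 * auxT m k (fun s => deriv m s * h s) z
      + auxT m k (deriv h) z := by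
  have hm' := hm.deriv
  have hh' := hh.deriv
  rw [← auxT_const_mul, ← auxT_add hm (by fun_prop) hh']
  unfold auxT
  rw [iteratedDeriv_succ']
  apply Filter.EventuallyEq.iteratedDeriv_eq
  filter_upwards [hm.eventually_analyticAt, hh.eventually_analyticAt] with s h1 h2
  have := (((h1.differentiableAt.hasDerivAt.const_mul (z ^ 2)).cexp).mul
    h2.differentiableAt.hasDerivAt).deriv
  refine Eq.trans ?_ (this.trans ?_)
  · rfl
  · ring

lemma auxT_hasDerivAt {m : ℂ → ℂ} (hm : AnalyticAt ℂ m 0) (hm0 : m 0 = 0) (k : ℕ) :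
    ∀ {h : ℂ → ℂ}, AnalyticAt ℂ h 0 → ∀ z : ℂ,
    HasDerivAt (auxT m k h) (2 * z * auxT m k (fun s => m s * h s) z) z := by
  have hm' := hm.deriv
  induction k with
  | zero =>
    intro h hh z
    have : auxT m 0 h = fun _ => h 0 := by
      funext z
      simp [auxT, hm0]
    rw [this]
    simpa [auxT, hm0] using hasDerivAt_const z (h 0)
  | succ k ih =>
    intro h hh z
    have hh' := hh.deriv
    have e : auxT m (k + 1) h = fun z => z ^ 2 * auxT m k (fun s => deriv m s * h s) z
      + auxT m k (deriv h) z := by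
      funext z
      exact auxT_succ hm hh k z
    rw [e, auxT_succ hm (by fun_prop)]
    have h1 : AnalyticAt ℂ (fun s => deriv m s * h s) 0 := by fun_prop
    have h2 : AnalyticAt ℂ (fun s => m s * deriv h s) 0 := by fun_prop
    have d := ((hasDerivAt_pow 2 z).mul (ih h1 z)).add (ih hh' z)
    have c1 : auxT m k (deriv fun s => m s * h s) z =
        auxT m k (fun s => deriv m s * h s) z + auxT m k (fun s => m s * deriv h s) z := by
      rw [← auxT_add hm h1 h2]
      apply auxT_congr
      filter_upwards [hm.eventually_analyticAt, hh.eventually_analyticAt] with s h1 h2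
      exact (h1.differentiableAt.hasDerivAt.mul h2.differentiableAt.hasDerivAt).deriv
    have c2 : auxT m k (fun s => deriv m s * (m s * h s)) z =
        auxT m k (fun s => m s * (deriv m s * h s)) z := by
      congr 1
      funext s
      ring
    rw [c1, c2]
    refine d.congr_deriv ?_
    simp
    ring

lemma iteratedDeriv_id_mul (k : ℕ) : ∀ {g : ℂ → ℂ}, AnalyticAt ℂ g 0 →
    iteratedDeriv (k + 1) (fun s => s * g s) 0 = (k + 1) * iteratedDeriv k g 0 := by
  induction k with
  | zero =>
    intro g hg
    have := ((hasDerivAt_id (0 : ℂ)).mul hg.differentiableAt.hasDerivAt).deriv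
    simp only [zero_add, iteratedDeriv_one, iteratedDeriv_zero]
    refine Eq.trans ?_ (this.trans ?_)
    · rfl
    · simp
  | succ k ih =>
    intro g hg
    have hg' := hg.deriv
    rw [iteratedDeriv_succ']
    have e : deriv (fun s => s * g s) =ᶠ[𝓝 0] fun s => g s + s * deriv g s := by
      filter_upwards [hg.eventually_analyticAt] with s h1
      have := ((hasDerivAt_id s).mul h1.differentiableAt.hasDerivAt).deriv
      refine Eq.trans ?_ (this.trans ?_)
      · rfl
      · simp
    have hx : AnalyticAt ℂ (fun s => s * deriv g s) 0 := by fun_prop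
    rw [e.iteratedDeriv_eq, iteratedDeriv_fun_add hg.contDiffAt hx.contDiffAt, ih hg',
      iteratedDeriv_succ']
    push_cast
    ring

lemma auxT_id_mul {m h : ℂ → ℂ} (hm : AnalyticAt ℂ m 0) (hh : AnalyticAt ℂ h 0)
    (k : ℕ) (z : ℂ) :
    auxT m (k + 1) (fun s => s * h s) z = (k + 1) * auxT m k h z := by
  unfold auxT
  rw [← iteratedDeriv_id_mul k (auxT_analytic hm hh z)]
  congr 1
  funext s
  ring

/-- The entire function `sinh(s/2)/(s/2)`. -/
noncomputable def auxE : ℂ → ℂ := dslope (fun s => 2 * Complex.sinh (s / 2)) 0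

lemma auxE_mul (s : ℂ) : s * auxE s = 2 * Complex.sinh (s / 2) := by
  simpa [auxE] using sub_smul_dslope (fun s => 2 * Complex.sinh (s / 2)) 0 s

lemma auxE_diff : Differentiable ℂ auxE := by
  rw [← differentiableOn_univ]
  refine (Complex.differentiableOn_dslope univ_mem).2 ?_
  fun_prop

lemma hasDerivAt_sinh_half (s : ℂ) :
    HasDerivAt (fun s => 2 * Complex.sinh (s / 2)) (Complex.cosh (s / 2)) s := by
  have := (((hasDerivAt_id s).div_const 2).csinh).const_mul 2
  refine this.congr_deriv ?_
  simp
  ring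

lemma hasDerivAt_cosh_half (s : ℂ) :
    HasDerivAt (fun s => Complex.cosh (s / 2)) (Complex.sinh (s / 2) / 2) s := by
  have := (((hasDerivAt_id s).div_const 2).ccosh)
  refine this.congr_deriv ?_
  simp
  ring

lemma auxE_zero : auxE 0 = 1 := by
  simp [auxE, dslope_same, (hasDerivAt_sinh_half 0).deriv]

lemma auxE_d1 (s : ℂ) : auxE s + s * deriv auxE s = Complex.cosh (s / 2) := by
  have h := ((hasDerivAt_id s).mul (auxE_diff s).hasDerivAt)
  have e : (id * auxE) = (fun s => 2 * Complex.sinh (s / 2)) := by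
    funext s
    exact auxE_mul s
  rw [e] at h
  simpa using h.unique (hasDerivAt_sinh_half s)

lemma auxE'_diff : Differentiable ℂ (deriv auxE) := fun s =>
  (auxE_diff.analyticAt s).deriv.differentiableAt

lemma auxE_d2 (s : ℂ) :
    2 * deriv auxE s + s * deriv (deriv auxE) s = s * auxE s / 4 := by
  have h := (auxE_diff s).hasDerivAt.add ((hasDerivAt_id s).mul (auxE'_diff s).hasDerivAt)
  have e : (auxE + id * deriv auxE) = (fun s => Complex.cosh (s / 2)) := by
    funext s
    exact auxE_d1 s
  rw [e] at h
  have := h.unique (hasDerivAt_cosh_half s)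
  simp at this
  rw [auxE_mul]
  linear_combination this

lemma auxE'_zero : deriv auxE 0 = 0 := by
  simpa using auxE_d2 0

lemma auxE_ne : ∀ᶠ s in 𝓝 (0 : ℂ), auxE s ≠ 0 :=
  auxE_diff.continuous.continuousAt.eventually_ne (by simp [auxE_zero])

lemma temmeMu_eq : temmeMu =ᶠ[𝓝 0] fun s => - deriv auxE s / auxE s := by
  filter_upwards [auxE_ne] with s hs
  unfold temmeMu
  split_ifs with h0
  · simp [h0, auxE'_zero]
  have h1 := auxE_mul s
  have h2 := auxE_d1 s
  have hsE : s * auxE s ≠ 0 := mul_ne_zero h0 hs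
  have hS : Complex.sinh (s / 2) ≠ 0 := by
    intro h
    rw [h1, h] at hsE
    simp at hsE
  have he : Complex.exp s - 1 = 2 * Complex.sinh (s / 2) * Complex.exp (s / 2) := by
    rw [Complex.two_sinh, sub_mul, ← Complex.exp_add, ← Complex.exp_add]
    simp
  have hc : Complex.exp (s / 2) = Complex.cosh (s / 2) + Complex.sinh (s / 2) :=
    (Complex.cosh_add_sinh _).symm
  have hne := Complex.exp_ne_zero (s / 2)
  have hsq := Complex.cosh_sq (s / 2)
  have hinv : (Complex.exp (s / 2))⁻¹ = Complex.cosh (s / 2) - Complex.sinh (s / 2) := by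
    rw [Complex.cosh_sub_sinh, Complex.exp_neg]
  have hd : deriv auxE s = (Complex.cosh (s / 2) - auxE s) / s := by
    field_simp
    linear_combination h2
  have hE : auxE s = 2 * Complex.sinh (s / 2) / s := by
    field_simp
    linear_combination h1
  rw [he, one_div (2 * _ * _), mul_inv, hinv, hd, hE]
  field_simp
  ring

lemma temmeBase_eq (b : ℂ) : temmeBase b =ᶠ[𝓝 0] fun s => ((auxE s)⁻¹) ^ b := by
  filter_upwards [auxE_ne] with s hs
  unfold temmeBase
  split_ifs with h0
  · simp [h0, auxE_zero]
  have h1 := auxE_mul s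
  congr 1
  have hS : Complex.sinh (s / 2) = s * auxE s / 2 := by
    linear_combination - h1 / 2
  rw [hS]
  field_simp

lemma temmeMu_analytic : AnalyticAt ℂ temmeMu 0 := by
  have h1 := auxE_diff.analyticAt 0
  have h2 := auxE'_diff.analyticAt 0
  refine AnalyticAt.congr ?_ temmeMu_eq.symm
  exact h2.neg.div h1 (by simp [auxE_zero])

lemma auxE_inv_analytic : AnalyticAt ℂ (fun s => (auxE s)⁻¹) 0 :=
  (auxE_diff.analyticAt 0).fun_inv (by simp [auxE_zero])

lemma temmeBase_analytic (b : ℂ) : AnalyticAt ℂ (temmeBase b) 0 := by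
  refine AnalyticAt.congr ?_ (temmeBase_eq b).symm
  exact auxE_inv_analytic.cpow analyticAt_const (by simp [auxE_zero])

lemma temmeMu_zero : temmeMu 0 = 0 := by simp [temmeMu]

lemma temmeBase_deriv (b : ℂ) :
    deriv (temmeBase b) =ᶠ[𝓝 0] fun s => b * (temmeMu s * temmeBase b s) := by
  have hslit : ∀ᶠ s in 𝓝 (0 : ℂ), (auxE s)⁻¹ ∈ Complex.slitPlane :=
    auxE_inv_analytic.continuousAt.eventually_mem
      (Complex.isOpen_slitPlane.mem_nhds (by simp [auxE_zero]))
  filter_upwards [auxE_ne, (temmeBase_eq b).deriv, temmeBase_eq b, temmeMu_eq, hslit]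
    with s h1 h2 h3 h4 h5
  rw [h2, h3, h4]
  have := (((auxE_diff s).hasDerivAt.fun_inv h1).cpow_const (c := b) h5).deriv
  rw [this, Complex.cpow_sub _ _ (inv_ne_zero h1), Complex.cpow_one]
  field_simp

lemma temmeMu_riccati :
    (fun s => 4 * deriv temmeMu s + 8 * dslope temmeMu 0 s) =ᶠ[𝓝 0]
      fun s => 4 * (temmeMu s * temmeMu s) + (-1) := by
  have hm := temmeMu_analytic
  have hm' := hm.deriv
  have hn : AnalyticAt ℂ (dslope temmeMu 0) 0 := by
    obtain ⟨p, hp⟩ := hm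
    exact ⟨_, hp.has_fpower_series_dslope_fslope⟩
  refine (ContinuousAt.eventuallyEq_nhds_iff_eventuallyEq_nhdsNE (by fun_prop) (by fun_prop)).1 ?_
  filter_upwards [self_mem_nhdsWithin, nhdsWithin_le_nhds auxE_ne,
    nhdsWithin_le_nhds temmeMu_eq, nhdsWithin_le_nhds temmeMu_eq.deriv] with s h0 h1 h2 h3
  have h0 : s ≠ 0 := h0
  have h4 : dslope temmeMu 0 s = temmeMu s / s := by
    have := sub_smul_dslope temmeMu 0 s
    simp [temmeMu_zero] at this
    rw [← this]
    field_simp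
  have h5 := ((auxE'_diff s).hasDerivAt.fun_neg.fun_div (auxE_diff s).hasDerivAt h1).deriv
  rw [h4, h3, h5, h2]
  have h6 := auxE_d2 s
  have h7 : deriv (deriv auxE) s = (s * auxE s / 4 - 2 * deriv auxE s) / s := by
    field_simp
    linear_combination 4 * h6
  rw [h7]
  field_simp
  ring

/-- The recursion (3.22)/(T:c) of the paper for the Maclaurin coefficients of
Temme's function: `4(k+1)c_{k+1} + 4z c_{k+1}' = c_k'' + ((2b-1)/z) c_k' - z² c_k`. -/
theorem temmeC_recursion (b : ℂ) :
    ∀ (k : ℕ) (z : ℂ), z ≠ 0 →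
      4 * ((k : ℂ) + 1) * temmeC b (k + 1) z + 4 * z * deriv (temmeC b (k + 1)) z =
        deriv (deriv (temmeC b k)) z + ((2 * b - 1) / z) * deriv (temmeC b k) z -
          z ^ 2 * temmeC b k z := by
  intro k z hz
  have hm := temmeMu_analytic
  have hm0 := temmeMu_zero
  have hm' := hm.deriv
  have hB := temmeBase_analytic b
  have hn : AnalyticAt ℂ (dslope temmeMu 0) 0 := by
    obtain ⟨p, hp⟩ := hm
    exact ⟨_, hp.has_fpower_series_dslope_fslope⟩
  have hmB : AnalyticAt ℂ (fun s => temmeMu s * temmeBase b s) 0 := by fun_prop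
  have hmmB : AnalyticAt ℂ (fun s => temmeMu s * (temmeMu s * temmeBase b s)) 0 := by fun_prop
  have hm'B : AnalyticAt ℂ (fun s => deriv temmeMu s * temmeBase b s) 0 := by fun_prop
  have hnB : AnalyticAt ℂ (fun s => dslope temmeMu 0 s * temmeBase b s) 0 := by fun_prop
  have hC : ∀ j, temmeC b j = fun z => auxT temmeMu j (temmeBase b) z / (j.factorial : ℂ) :=
    fun j => rfl
  have hD : ∀ j, deriv (temmeC b j) = fun z =>
      2 * z * auxT temmeMu j (fun s => temmeMu s * temmeBase b s) z / (j.factorial : ℂ) := by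
    intro j
    funext z
    rw [hC]
    exact ((auxT_hasDerivAt hm hm0 j hB z).div_const _).deriv
  have hDD : deriv (deriv (temmeC b k)) z =
      (2 * auxT temmeMu k (fun s => temmeMu s * temmeBase b s) z + 4 * z ^ 2 *
        auxT temmeMu k (fun s => temmeMu s * (temmeMu s * temmeBase b s)) z)
        / (k.factorial : ℂ) := by
    rw [hD]
    have := ((((hasDerivAt_id z).const_mul 2).fun_mul (auxT_hasDerivAt hm hm0 k hmB z)).div_const
      (k.factorial : ℂ)).deriv
    refine Eq.trans ?_ (this.trans ?_)
    · rfl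
    · simp
      ring
  rw [hDD, hD, hD, hC, hC]
  have e1 : auxT temmeMu (k + 1) (temmeBase b) z =
      z ^ 2 * auxT temmeMu k (fun s => deriv temmeMu s * temmeBase b s) z
      + b * auxT temmeMu k (fun s => temmeMu s * temmeBase b s) z := by
    rw [auxT_succ hm hB, auxT_congr _ _ _ (temmeBase_deriv b), auxT_const_mul]
  have e2 : auxT temmeMu (k + 1) (fun s => temmeMu s * temmeBase b s) z =
      (k + 1) * auxT temmeMu k (fun s => dslope temmeMu 0 s * temmeBase b s) z := by
    rw [← auxT_id_mul hm hnB]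
    congr 1
    funext s
    have := sub_smul_dslope temmeMu 0 s
    simp [temmeMu_zero] at this
    rw [← this]
    ring
  have e3 : 4 * auxT temmeMu k (fun s => deriv temmeMu s * temmeBase b s) z
      + 8 * auxT temmeMu k (fun s => dslope temmeMu 0 s * temmeBase b s) z
      = 4 * auxT temmeMu k (fun s => temmeMu s * (temmeMu s * temmeBase b s)) z
        + (-1) * auxT temmeMu k (temmeBase b) z := by
    simp only [← auxT_const_mul]
    rw [← auxT_add hm (by fun_prop) (by fun_prop), ← auxT_add hm (by fun_prop) (by fun_prop)]
    apply auxT_congr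
    filter_upwards [temmeMu_riccati] with s hs
    linear_combination temmeBase b s * hs
  have hk : (k.factorial : ℂ) ≠ 0 := by exact_mod_cast k.factorial_ne_zero
  have hk1 : (k : ℂ) + 1 ≠ 0 := by exact_mod_cast k.succ_ne_zero
  simp only [e1, e2, Nat.factorial_succ]
  generalize auxT temmeMu k (fun s => temmeMu s * (temmeMu s * temmeBase b s)) z = A at *
  push_cast
  field_simp
  linear_combination z ^ 2 * e3
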